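/- arXiv:1904.00189 — 2 statements merged into one kernel-verified Lean document; each statement's English description precedes it below -/
import Mathlib

section
/- Let (A, ≤_A) and (B, ≤_B) be linear orders, let R ⊆ A × B be an interval-preserving relation, and suppose (a₂, b₂) ∈ c1(R), b ≤_B b₂, and R⁻¹(b) ≠ ∅. Then (a₂, b) ∈ c1(R). -/
/-- An interval of a linear order: a set closed under betweenness. -/
def IsInterval {A : Type*} [LinearOrder A] (I : Set A) : Prop :=
  ∀ ⦃a b c : A⦄, a ∈ I → c ∈ I → a ≤ b → b ≤ c → b ∈ I

/-- A relation `R ⊆ A × B` between linear orders is interval-preserving if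
the image of every interval of `A` is an interval of `(R(A), ≤_B)`, and the
preimage of every interval of `B` is an interval of `(R⁻¹(B), ≤_A)`. -/
def IntervalPreserving {A B : Type*} [LinearOrder A] [LinearOrder B]
    (R : A → B → Prop) : Prop :=
  (∀ I : Set A, IsInterval I → ∀ b1 b b2 : B,
      (∃ a ∈ I, R a b1) → (∃ a ∈ I, R a b2) → (∃ a, R a b) →
      b1 ≤ b → b ≤ b2 → ∃ a ∈ I, R a b) ∧
  (∀ J : Set B, IsInterval J → ∀ a1 a a2 : A,
      (∃ b ∈ J, R a1 b) → (∃ b ∈ J, R a2 b) → (∃ b, R a b) →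
      a1 ≤ a → a ≤ a2 → ∃ b ∈ J, R a b)

/-- `c1(R) = {(a,b) : R(a) ≠ ∅ ∧ b < R(a) ∧ R⁻¹(b) ≠ ∅ ∧ a < R⁻¹(b)}`. -/
def c1 {A B : Type*} [LinearOrder A] [LinearOrder B] (R : A → B → Prop)
    (a : A) (b : B) : Prop :=
  (∃ b', R a b') ∧ (∀ b', R a b' → b < b') ∧
  (∃ a', R a' b) ∧ (∀ a', R a' b → a < a')

/-- `c2(R) = {(a,b) : R(a) ≠ ∅ ∧ b < R(a) ∧ R⁻¹(b) ≠ ∅ ∧ R⁻¹(b) < a}`. -/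
def c2 {A B : Type*} [LinearOrder A] [LinearOrder B] (R : A → B → Prop)
    (a : A) (b : B) : Prop :=
  (∃ b', R a b') ∧ (∀ b', R a b' → b < b') ∧
  (∃ a', R a' b) ∧ (∀ a', R a' b → a' < a)

/-- `c3(R) = {(a,b) : R(a) ≠ ∅ ∧ R(a) < b ∧ R⁻¹(b) ≠ ∅ ∧ a < R⁻¹(b)}`. -/
def c3 {A B : Type*} [LinearOrder A] [LinearOrder B] (R : A → B → Prop)
    (a : A) (b : B) : Prop :=
  (∃ b', R a b') ∧ (∀ b', R a b' → b' < b) ∧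
  (∃ a', R a' b) ∧ (∀ a', R a' b → a < a')

/-- `c4(R) = {(a,b) : R(a) ≠ ∅ ∧ R(a) < b ∧ R⁻¹(b) ≠ ∅ ∧ R⁻¹(b) < a}`. -/
def c4 {A B : Type*} [LinearOrder A] [LinearOrder B] (R : A → B → Prop)
    (a : A) (b : B) : Prop :=
  (∃ b', R a b') ∧ (∀ b', R a b' → b' < b) ∧
  (∃ a', R a' b) ∧ (∀ a', R a' b → a' < a)

theorem c1_left_closed {A B : Type*} [LinearOrder A] [LinearOrder B]
    (R : A → B → Prop) (hR : IntervalPreserving R)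
    (a₂ : A) (b b₂ : B) (h : c1 R a₂ b₂) (hb : b ≤ b₂) (hne : ∃ a, R a b) :
    c1 R a₂ b := by
  obtain ⟨⟨b', hb'⟩, h2, h3, h4⟩ := h
  refine ⟨⟨b', hb'⟩, fun x hx => lt_of_le_of_lt hb (h2 x hx), hne, fun a' ha' => ?_⟩
  by_contra hlt
  obtain ⟨x, hx, hxR⟩ := hR.1 (Set.Iic a₂) (fun _ _ _ _ hc _ h => le_trans h hc) b b₂ b'
    ⟨a', not_lt.mp hlt, ha'⟩ ⟨a₂, le_refl a₂, hb'⟩ h3 hb (h2 b' hb').le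
  exact absurd (h4 x hxR) (not_lt.mpr hx)
end

section
/- Let (A, ≤_A) and (B, ≤_B) be linear orders and let R ⊆ A × B be an interval-preserving relation. Then the complement (A × B) \ R equals the union of the following six relations: {(a,b) : R(a) = ∅}, {(a,b) : R⁻¹(b) = ∅}, c1(R), c2(R), c3(R), and c4(R). -/
theorem complement_eq_union {A B : Type*} [LinearOrder A] [LinearOrder B]
    (R : A → B → Prop) (hR : IntervalPreserving R) :
    ∀ (a : A) (b : B), ¬ R a b ↔
      ((¬ ∃ b', R a b') ∨ (¬ ∃ a', R a' b) ∨
       c1 R a b ∨ c2 R a b ∨ c3 R a b ∨ c4 R a b) := by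
  intro a b
  constructor
  · intro h
    by_cases hb : ∃ b', R a b'
    swap
    · exact Or.inl hb
    by_cases ha : ∃ a', R a' b
    swap
    · exact Or.inr (Or.inl ha)
    have h1 : (∀ b', R a b' → b < b') ∨ (∀ b', R a b' → b' < b) := by
      by_contra hc
      push Not at hc
      obtain ⟨⟨x, hx, hxb⟩, y, hy, hyb⟩ := hc
      obtain ⟨a', rfl, h'⟩ := hR.1 {a}
        (fun p q r hp hr hpq hqr => by
          rw [Set.mem_singleton_iff] at *
          subst hp
          subst hr
          exact le_antisymm hqr hpq)
        x b y ⟨a, rfl, hx⟩ ⟨a, rfl, hy⟩ ha hxb hyb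
      exact h h'
    have h2 : (∀ a', R a' b → a < a') ∨ (∀ a', R a' b → a' < a) := by
      by_contra hc
      push Not at hc
      obtain ⟨⟨x, hx, hxa⟩, y, hy, hya⟩ := hc
      obtain ⟨b', rfl, h'⟩ := hR.2 {b}
        (fun p q r hp hr hpq hqr => by
          rw [Set.mem_singleton_iff] at *
          subst hp
          subst hr
          exact le_antisymm hqr hpq)
        x a y ⟨b, rfl, hx⟩ ⟨b, rfl, hy⟩ hb hxa hya
      exact h h'
    rcases h1 with h1 | h1 <;> rcases h2 with h2 | h2
    · exact Or.inr (Or.inr (Or.inl ⟨hb, h1, ha, h2⟩))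
    · exact Or.inr (Or.inr (Or.inr (Or.inl ⟨hb, h1, ha, h2⟩)))
    · exact Or.inr (Or.inr (Or.inr (Or.inr (Or.inl ⟨hb, h1, ha, h2⟩))))
    · exact Or.inr (Or.inr (Or.inr (Or.inr (Or.inr ⟨hb, h1, ha, h2⟩))))
  · rintro (h | h | h | h | h | h) hab
    · exact h ⟨b, hab⟩
    · exact h ⟨a, hab⟩
    all_goals exact lt_irrefl _ (h.2.1 b hab)
end
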